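/- Let l ∈ {−1, 0, 1} and let G_{Λ_l}(z) := ∏_{n≥l} (1 − z/λ_n) be the entire function defined by this locally uniformly convergent product. There exists a constant C ≥ 1 such that for every λ ∈ Λ_l one has C^{−1} |λ|^{−(3/2+l)} ≤ |G'_{Λ_l}(λ)| e^{−φ(λ)} ≤ C |λ|^{−(3/2+l)}. -/

import Mathlib

open MeasureTheory Complex
open scoped ENNReal

noncomputable section

/-- `log⁺ t = max (log t) 0`. -/
def logPlus (t : ℝ) : ℝ := max (Real.log t) 0

/-- The weight `φ(z) = (log⁺ |z|)²` (the case `α = 1`). -/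
def phi1 (z : ℂ) : ℝ := (logPlus ‖z‖) ^ 2

/-- The point `λ_n = e^{(1+n)/2} e^{iθ_n}`. -/
def lamPt (θ : ℤ → ℝ) (n : ℤ) : ℂ :=
  (Real.exp ((1 + (n : ℝ)) / 2) : ℂ) * Complex.exp ((θ n : ℂ) * Complex.I)

/-- The set `Λ_l = {λ_n : n ≥ l}`. -/
def LamSet (θ : ℤ → ℝ) (l : ℤ) : Set ℂ := {w : ℂ | ∃ n : ℤ, l ≤ n ∧ w = lamPt θ n}

lemma s8_norm (θ : ℤ → ℝ) (n : ℤ) : ‖lamPt θ n‖ = Real.exp ((1 + (n : ℝ)) / 2) := by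
  unfold lamPt
  rw [norm_mul, Complex.norm_exp_ofReal_mul_I, mul_one, Complex.norm_real, Real.norm_eq_abs,
    abs_of_pos (Real.exp_pos _)]

lemma s8_ne (θ : ℤ → ℝ) (n : ℤ) : lamPt θ n ≠ 0 := by
  rw [← norm_pos_iff, s8_norm]; exact Real.exp_pos _

def s8r : ℝ := Real.exp (-(1 / 2))

lemma s8r_pos : 0 < s8r := Real.exp_pos _

lemma s8r_lt : s8r < 1 := by
  unfold s8r; rw [Real.exp_lt_one_iff]; norm_num

lemma s8r_pow (k : ℕ) : s8r ^ k = Real.exp (-((k : ℝ) / 2)) := by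
  unfold s8r; rw [← Real.exp_nat_mul]; congr 1; ring

lemma s8_ratio (θ : ℤ → ℝ) (a b : ℤ) (k : ℕ) (h : b = a + k) :
    ‖lamPt θ a / lamPt θ b‖ = s8r ^ k := by
  rw [norm_div, s8_norm, s8_norm, s8r_pow, ← Real.exp_sub, h]
  congr 1; push_cast; ring

def s8A : ℝ := (1 - s8r)⁻¹ * (1 - s8r)⁻¹

lemma s8_sum (K : ℕ) : ∑ k ∈ Finset.range K, s8r ^ (k + 1) ≤ (1 - s8r)⁻¹ := by
  have hs := summable_geometric_of_lt_one s8r_pos.le s8r_lt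
  rw [← tsum_geometric_of_lt_one s8r_pos.le s8r_lt]
  calc _ ≤ ∑ k ∈ Finset.range K, s8r ^ k := by
        refine Finset.sum_le_sum fun k _ => ?_
        exact pow_le_pow_of_le_one s8r_pos.le s8r_lt.le (Nat.le_succ k)
    _ ≤ _ := hs.sum_le_tsum _ (fun k _ => (pow_pos s8r_pos k).le)

lemma s8_factor (w : ℂ) (k : ℕ) (hw : ‖w‖ = s8r ^ (k + 1)) :
    Real.exp (-((1 - s8r)⁻¹ * s8r ^ (k + 1))) ≤ ‖1 - w‖ ∧
      ‖1 - w‖ ≤ Real.exp ((1 - s8r)⁻¹ * s8r ^ (k + 1)) := by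
  have h1 : 0 < 1 - s8r := sub_pos.2 s8r_lt
  have hx0 : 0 < s8r ^ (k + 1) := pow_pos s8r_pos _
  have hx1 : s8r ^ (k + 1) ≤ s8r := by
    simpa using pow_le_pow_of_le_one s8r_pos.le s8r_lt.le (Nat.succ_le_succ (Nat.zero_le k))
  set x := s8r ^ (k + 1)
  have hinv : 1 ≤ (1 - s8r)⁻¹ := by
    rw [one_le_inv₀ h1]; linarith [s8r_pos]
  constructor
  · have h2 : 1 - x ≤ ‖1 - w‖ := by
      have := norm_sub_norm_le (1 : ℂ) w
      rw [norm_one, hw] at this; exact this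
    refine le_trans ?_ h2
    have h3 : 0 < 1 - x := by linarith
    rw [Real.exp_neg, inv_le_comm₀ (Real.exp_pos _) h3]
    have h4 : (1 - x)⁻¹ = x * (1 - x)⁻¹ + 1 := by field_simp; ring
    have h5 : (1 - x)⁻¹ ≤ (1 - s8r)⁻¹ := inv_anti₀ h1 (by linarith)
    calc (1 - x)⁻¹ = x * (1 - x)⁻¹ + 1 := h4
      _ ≤ (1 - s8r)⁻¹ * x + 1 := by nlinarith
      _ ≤ _ := Real.add_one_le_exp _
  · calc ‖1 - w‖ ≤ ‖(1 : ℂ)‖ + ‖w‖ := norm_sub_le _ _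
      _ = 1 + x := by rw [norm_one, hw]
      _ ≤ (1 - s8r)⁻¹ * x + 1 := by nlinarith
      _ ≤ _ := Real.add_one_le_exp _

lemma s8_prod (w : ℕ → ℂ) (K : ℕ) (hw : ∀ k < K, ‖w k‖ = s8r ^ (k + 1)) :
    Real.exp (-s8A) ≤ ∏ k ∈ Finset.range K, ‖1 - w k‖ ∧
      ∏ k ∈ Finset.range K, ‖1 - w k‖ ≤ Real.exp s8A := by
  have h1 : 0 < (1 - s8r)⁻¹ := inv_pos.2 (sub_pos.2 s8r_lt)
  have hS := mul_le_mul_of_nonneg_left (s8_sum K) h1.le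
  rw [Finset.mul_sum] at hS
  constructor
  · calc Real.exp (-s8A)
        ≤ Real.exp (∑ k ∈ Finset.range K, -((1 - s8r)⁻¹ * s8r ^ (k + 1))) := by
          rw [Real.exp_le_exp, Finset.sum_neg_distrib]; exact neg_le_neg hS
      _ ≤ _ := by
          rw [Real.exp_sum]
          exact Finset.prod_le_prod (fun _ _ => (Real.exp_pos _).le)
            (fun k hk => (s8_factor _ k (hw k (Finset.mem_range.1 hk))).1)
  · calc _ ≤ Real.exp (∑ k ∈ Finset.range K, ((1 - s8r)⁻¹ * s8r ^ (k + 1))) := by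
          rw [Real.exp_sum]
          exact Finset.prod_le_prod (fun _ _ => norm_nonneg _)
            (fun k hk => (s8_factor _ k (hw k (Finset.mem_range.1 hk))).2)
      _ ≤ _ := by rw [Real.exp_le_exp]; exact hS

lemma s8_loc (θ : ℤ → ℝ) (s : ℤ) (R : ℝ) :
    HasProdLocallyUniformlyOn (fun (k : ℕ) (z : ℂ) => 1 + -(z / lamPt θ (s + k)))
      (fun z => ∏' k : ℕ, (1 + -(z / lamPt θ (s + k)))) (Metric.ball (0 : ℂ) R) := by
  have hu : Summable fun k : ℕ => R * ‖lamPt θ s‖⁻¹ * s8r ^ k :=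
    (summable_geometric_of_lt_one s8r_pos.le s8r_lt).mul_left _
  refine Summable.hasProdLocallyUniformlyOn_nat_one_add Metric.isOpen_ball hu ?_ ?_
  · refine Filter.Eventually.of_forall fun k z hz => ?_
    rw [mem_ball_zero_iff] at hz
    have h1 := s8_ratio θ s (s + k) k rfl
    have h2 : -(z / lamPt θ (s + k)) = -(z * (lamPt θ s)⁻¹ * (lamPt θ s / lamPt θ (s + k))) := by
      have := s8_ne θ s
      have := s8_ne θ (s + k)
      field_simp
    rw [h2, norm_neg, norm_mul, h1, norm_mul, norm_inv]
    have := pow_pos s8r_pos k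
    gcongr
  · intro k
    have := s8_ne θ (s + k)
    fun_prop

lemma s8_mult (θ : ℤ → ℝ) (s : ℤ) (z : ℂ) :
    Multipliable fun k : ℕ => 1 - z / lamPt θ (s + k) := by
  have h := (s8_loc θ s (‖z‖ + 1)).hasProd (x := z) (by simp)
  simp only [← sub_eq_add_neg] at h
  exact h.multipliable

lemma s8_diff (θ : ℤ → ℝ) (s : ℤ) :
    Differentiable ℂ fun z : ℂ => ∏' k : ℕ, (1 - z / lamPt θ (s + k)) := by
  intro z
  have h := s8_loc θ s (‖z‖ + 1)
  rw [hasProdLocallyUniformlyOn_iff_tendstoLocallyUniformlyOn] at h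
  have h2 := h.differentiableOn (Filter.Eventually.of_forall fun t => by
    have : ∀ k : ℕ, lamPt θ (s + k) ≠ 0 := fun k => s8_ne θ _
    fun_prop) Metric.isOpen_ball
  simp only [← sub_eq_add_neg] at h2
  exact h2.differentiableAt (Metric.isOpen_ball.mem_nhds (by simp))

lemma s8_deriv (θ : ℤ → ℝ) (l : ℤ) (m : ℕ) :
    deriv (fun z : ℂ => ∏' k : ℕ, (1 - z / lamPt θ (l + k))) (lamPt θ (l + m)) =
      -(lamPt θ (l + m))⁻¹ * ((∏ k ∈ Finset.range m, (1 - lamPt θ (l + m) / lamPt θ (l + k))) *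
        ∏' k : ℕ, (1 - lamPt θ (l + m) / lamPt θ (l + m + 1 + k))) := by
  have hne := s8_ne θ (l + m)
  have e : (fun z : ℂ => ∏' k : ℕ, (1 - z / lamPt θ (l + k))) = fun z : ℂ =>
      (1 - z / lamPt θ (l + m)) * ((∏ k ∈ Finset.range m, (1 - z / lamPt θ (l + k))) *
        ∏' k : ℕ, (1 - z / lamPt θ (l + m + 1 + k))) := by
    funext z
    have hidx : ∀ k : ℕ, l + ((k + (m + 1) : ℕ) : ℤ) = l + m + 1 + k := by
      intro k; push_cast; ring
    have hm : Multipliable fun k : ℕ =>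
        (fun j : ℕ => 1 - z / lamPt θ (l + j)) (k + (m + 1)) := by
      simp only [hidx]; exact s8_mult θ _ z
    have := Multipliable.prod_mul_tprod_nat_mul' (f := fun j : ℕ => 1 - z / lamPt θ (l + j))
      (k := m + 1) hm
    rw [← this, Finset.prod_range_succ]
    simp only [hidx]
    ring
  rw [e]
  have h1 : HasDerivAt (fun z : ℂ => 1 - z / lamPt θ (l + m)) (-(lamPt θ (l + m))⁻¹)
      (lamPt θ (l + m)) := by
    have := ((hasDerivAt_id (lamPt θ (l + m))).div_const (lamPt θ (l + m))).const_sub 1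
    simpa using this
  have h2 : DifferentiableAt ℂ (fun z : ℂ =>
      (∏ k ∈ Finset.range m, (1 - z / lamPt θ (l + k))) *
        ∏' k : ℕ, (1 - z / lamPt θ (l + m + 1 + k))) (lamPt θ (l + m)) := by
    refine DifferentiableAt.mul ?_ (s8_diff θ _ _)
    have : ∀ k : ℕ, lamPt θ (l + k) ≠ 0 := fun k => s8_ne θ _
    fun_prop
  have := (h1.mul h2.hasDerivAt).deriv
  refine Eq.trans this ?_
  simp [div_self hne]

lemma s8_tail (θ : ℤ → ℝ) (n : ℤ) :
    Real.exp (-s8A) ≤ ‖∏' k : ℕ, (1 - lamPt θ n / lamPt θ (n + 1 + k))‖ ∧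
      ‖∏' k : ℕ, (1 - lamPt θ n / lamPt θ (n + 1 + k))‖ ≤ Real.exp s8A := by
  have ht := (s8_mult θ (n + 1) (lamPt θ n)).hasProd.tendsto_prod_nat.norm
  have hb := fun K => s8_prod (fun k : ℕ => lamPt θ n / lamPt θ (n + 1 + k)) K
    (fun k _ => s8_ratio θ _ _ (k + 1) (by push_cast; ring))
  simp only [norm_prod] at ht
  exact ⟨ge_of_tendsto' ht fun K => (hb K).1, le_of_tendsto' ht fun K => (hb K).2⟩

lemma s8_head (θ : ℤ → ℝ) (l : ℤ) (m : ℕ) :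
    ∃ P : ℝ, Real.exp (-s8A) ≤ P ∧ P ≤ Real.exp s8A ∧
      ‖∏ k ∈ Finset.range m, (1 - lamPt θ (l + m) / lamPt θ (l + k))‖ =
        Real.exp ((m : ℝ) * (m + 1) / 4) * P := by
  obtain ⟨h1, h2⟩ := s8_prod (fun k : ℕ => lamPt θ (l + (m - 1 - k : ℕ)) / lamPt θ (l + m)) m
    (fun k hk => s8_ratio θ _ _ (k + 1) (by push_cast [Nat.sub_sub]; omega))
  refine ⟨_, h1, h2, ?_⟩
  have hS : ∀ m : ℕ, ∑ k ∈ Finset.range m, (((k : ℝ) + 1) / 2) = (m : ℝ) * (m + 1) / 4 := by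
    intro m
    induction m with
    | zero => simp
    | succ m ih => rw [Finset.sum_range_succ, ih]; push_cast; ring
  rw [← hS, Real.exp_sum, ← Finset.prod_mul_distrib, norm_prod,
    ← Finset.prod_range_reflect (fun k : ℕ => ‖1 - lamPt θ (l + m) / lamPt θ (l + k)‖)]
  refine Finset.prod_congr rfl fun k hk => ?_
  have hk := Finset.mem_range.1 hk
  have hr := s8_ratio θ (l + (m - 1 - k : ℕ)) (l + m) (k + 1) (by push_cast [Nat.sub_sub]; omega)
  have ha := s8_ne θ (l + (m - 1 - k : ℕ))
  have hb := s8_ne θ (l + m)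
  set a := lamPt θ (l + (m - 1 - k : ℕ))
  set b := lamPt θ (l + m)
  have e : 1 - b / a = -((a / b)⁻¹ * (1 - a / b)) := by field_simp; ring
  rw [e, norm_neg, norm_mul, norm_inv, hr, s8r_pow, ← Real.exp_neg]
  congr 2
  push_cast; ring

/-- for the entire function `G_{Λ_l}(z) = ∏_{n≥l}(1 - z/λ_n)` one has
`|G'_{Λ_l}(λ)| e^{-φ(λ)} ≍ |λ|^{-(3/2+l)}` for `λ ∈ Λ_l`. -/
theorem statement8 (l : ℤ) (hl : l = -1 ∨ l = 0 ∨ l = 1) (θ : ℤ → ℝ)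
    (G : ℂ → ℂ) (hG : G = fun z : ℂ => ∏' k : ℕ, (1 - z / lamPt θ (l + k))) :
    ∃ C : ℝ, 1 ≤ C ∧ ∀ n : ℤ, l ≤ n →
      (1 / C) * ‖lamPt θ n‖ ^ (-(3 / 2 + (l : ℝ))) ≤
        ‖deriv G (lamPt θ n)‖ * Real.exp (-(phi1 (lamPt θ n))) ∧
      ‖deriv G (lamPt θ n)‖ * Real.exp (-(phi1 (lamPt θ n))) ≤
        C * ‖lamPt θ n‖ ^ (-(3 / 2 + (l : ℝ))) := by
  have hA : 0 ≤ s8A := mul_self_nonneg _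
  have hll : (0 : ℝ) ≤ (l : ℝ) * (l + 1) / 4 ∧ (l : ℝ) * (l + 1) / 4 ≤ 1 := by
    rcases hl with h | h | h <;> subst h <;> norm_num
  have hl1 : -1 ≤ l := by omega
  refine ⟨Real.exp (2 * s8A + 1), Real.one_le_exp (by linarith), fun n hn => ?_⟩
  obtain ⟨m, rfl⟩ : ∃ m : ℕ, n = l + m := ⟨(n - l).toNat, by omega⟩
  have hN : (0 : ℝ) ≤ 1 + ((l + m : ℤ) : ℝ) := by
    have : (0 : ℤ) ≤ 1 + (l + m) := by omega
    exact_mod_cast this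
  obtain ⟨P, hP1, hP2, hP⟩ := s8_head θ l m
  obtain ⟨hT1, hT2⟩ := s8_tail θ (l + m)
  set T := ‖∏' k : ℕ, (1 - lamPt θ (l + m) / lamPt θ (l + m + 1 + k))‖ with hTdef
  have hphi : phi1 (lamPt θ (l + m)) = ((1 + ((l + m : ℤ) : ℝ)) / 2) ^ 2 := by
    unfold phi1 logPlus
    rw [s8_norm, Real.log_exp, max_eq_left (by linarith)]
  have key : ‖deriv G (lamPt θ (l + m))‖ * Real.exp (-(phi1 (lamPt θ (l + m)))) =
      Real.exp ((l : ℝ) * (l + 1) / 4) * (P * T) *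
        ‖lamPt θ (l + m)‖ ^ (-(3 / 2 + (l : ℝ))) := by
    rw [hG, s8_deriv, norm_mul, norm_mul, norm_neg, norm_inv, ← hTdef, hP, hphi, s8_norm,
      ← Real.exp_mul, ← Real.exp_neg]
    have : Real.exp (-((1 + ((l + m : ℤ) : ℝ)) / 2)) * Real.exp ((m : ℝ) * (m + 1) / 4) *
        Real.exp (-((1 + ((l + m : ℤ) : ℝ)) / 2) ^ 2) = Real.exp ((l : ℝ) * (l + 1) / 4) *
        Real.exp ((1 + ((l + m : ℤ) : ℝ)) / 2 * -(3 / 2 + (l : ℝ))) := by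
      rw [← Real.exp_add, ← Real.exp_add, ← Real.exp_add]
      congr 1
      push_cast; ring
    linear_combination (P * T) * this
  have hX : 0 ≤ ‖lamPt θ (l + m)‖ ^ (-(3 / 2 + (l : ℝ))) := Real.rpow_nonneg (norm_nonneg _) _
  have hP0 : 0 ≤ P := (Real.exp_pos _).le.trans hP1
  rw [key]
  constructor
  · refine mul_le_mul_of_nonneg_right ?_ hX
    calc 1 / Real.exp (2 * s8A + 1) ≤ 1 * (Real.exp (-s8A) * Real.exp (-s8A)) := by
          rw [one_div, ← Real.exp_neg, one_mul, ← Real.exp_add, Real.exp_le_exp]; linarith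
      _ ≤ _ := by
          have := Real.one_le_exp hll.1
          gcongr
  · refine mul_le_mul_of_nonneg_right ?_ hX
    calc _ ≤ Real.exp 1 * (Real.exp s8A * Real.exp s8A) := by
          have := hll.2
          gcongr
      _ = _ := by rw [← Real.exp_add, ← Real.exp_add]; congr 1; ring

end
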